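/- arXiv:2311.09095 — 5 statements merged into one kernel-verified Lean document; each statement's English description precedes it below -/
import Mathlib

section
/- Let X and Y be finite nonempty sets, let A ∈ {0,1}^{X×Y}, let δ, ε > 0 and let k, ℓ ≥ 1 be integers, and assume ‖A‖_{U(k,ℓ)} ≥ (1+ε)δ. Then one of the following two cases applies: (1) the number of x ∈ X with deg_A(x) ≥ δ is at least (ε/2)·δ^{kℓ}·|X|; or (2) k > 1 and there exists x ∈ X such that deg_A(x) ≥ δ^k and ‖A_x‖_{U(k−1,ℓ)} ≥ (1+ε)δ. -/
open Finset

/-- The density `E[A]` of a matrix restricted to the rectangle `Sx × Sy`. -/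
noncomputable def density {X Y : Type*} (Sx : Finset X) (Sy : Finset Y) (A : X → Y → ℝ) : ℝ :=
  (∑ x ∈ Sx, ∑ y ∈ Sy, A x y) / ((Sx.card : ℝ) * (Sy.card : ℝ))

/-- The (relative) degree `deg_A(x)` of a row `x`, with columns restricted to `Sy`. -/
noncomputable def rowDeg {X Y : Type*} (Sy : Finset Y) (A : X → Y → ℝ) (x : X) : ℝ :=
  (∑ y ∈ Sy, A x y) / (Sy.card : ℝ)

/-- The `(k,ℓ)`-grid norm `‖A‖_{U(k,ℓ)}` of a matrix restricted to the rectangle `Sx × Sy`: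
the `(kℓ)`-th root of the average of `∏_{i,j} A(x_i, y_j)` over all tuples
`x_1, …, x_k ∈ Sx`, `y_1, …, y_ℓ ∈ Sy`. -/
noncomputable def gridNorm {X Y : Type*} (Sx : Finset X) (Sy : Finset Y) (k l : ℕ)
    (A : X → Y → ℝ) : ℝ :=
  ((∑ xs ∈ Fintype.piFinset (fun _ : Fin k => Sx),
      ∑ ys ∈ Fintype.piFinset (fun _ : Fin l => Sy),
      ∏ i : Fin k, ∏ j : Fin l, A (xs i) (ys j)) /
    ((Sx.card : ℝ) ^ k * (Sy.card : ℝ) ^ l)) ^ ((1 : ℝ) / (k * l))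

/-- `A` (restricted to `Sx × Sy`) is `(ε,k,ℓ)`-regular if `‖A‖_{U(k,ℓ)} ≤ (1+ε)·E[A]`. -/
def GridRegular {X Y : Type*} (Sx : Finset X) (Sy : Finset Y) (ε : ℝ) (k l : ℕ)
    (A : X → Y → ℝ) : Prop :=
  gridNorm Sx Sy k l A ≤ (1 + ε) * density Sx Sy A

/-- `A` (restricted to `Sx × Sy`) is `ε`-min-degree if every row has degree
at least `(1-ε)·E[A]`. -/
def MinDegree {X Y : Type*} (Sx : Finset X) (Sy : Finset Y) (ε : ℝ) (A : X → Y → ℝ) : Prop :=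
  ∀ x ∈ Sx, (1 - ε) * density Sx Sy A ≤ rowDeg Sy A x

/-- `A` is a zero-one matrix on the rectangle `Sx × Sy`. -/
def ZeroOne {X Y : Type*} (Sx : Finset X) (Sy : Finset Y) (A : X → Y → ℝ) : Prop :=
  ∀ x ∈ Sx, ∀ y ∈ Sy, A x y = 0 ∨ A x y = 1

open scoped Classical

/-- The unnormalised count of the `k × l` grids of `A` with rows anywhere and columns in `Sy`. -/
noncomputable def gridSum {X Y : Type*} [Fintype X] (Sy : Finset Y) (k l : ℕ)
    (A : X → Y → ℝ) : ℝ :=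
  ∑ xs ∈ Fintype.piFinset (fun _ : Fin k => (univ : Finset X)),
    ∑ ys ∈ Fintype.piFinset (fun _ : Fin l => Sy), ∏ i : Fin k, ∏ j : Fin l, A (xs i) (ys j)

theorem rowDeg_eq_card_div {X Y : Type*} [Fintype Y] {A : X → Y → ℝ}
    (hA : ∀ x y, A x y = 0 ∨ A x y = 1) (x : X) :
    rowDeg univ A x = ((univ.filter fun y => A x y = 1).card : ℝ) / Fintype.card Y := by
  rw [rowDeg, card_univ, card_filter]
  push_cast
  congr 1
  refine sum_congr rfl fun y _ => ?_
  rcases hA x y with h | h <;> simp [h]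

section GridSum

variable {X Y : Type*} [Fintype X] {A : X → Y → ℝ}

theorem gridSum_nonneg (h0 : ∀ x y, 0 ≤ A x y) (Sy : Finset Y) (k l : ℕ) :
    0 ≤ gridSum Sy k l A :=
  sum_nonneg fun _ _ => sum_nonneg fun _ _ => prod_nonneg fun _ _ => prod_nonneg fun _ _ => h0 _ _

theorem gridSum_le (h0 : ∀ x y, 0 ≤ A x y) (h1 : ∀ x y, A x y ≤ 1) (Sy : Finset Y) (k l : ℕ) :
    gridSum Sy k l A ≤ (Fintype.card X : ℝ) ^ k * (Sy.card : ℝ) ^ l := by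
  calc gridSum Sy k l A
      ≤ ∑ _xs ∈ Fintype.piFinset (fun _ : Fin k => (univ : Finset X)),
          ∑ _ys ∈ Fintype.piFinset (fun _ : Fin l => Sy), (1 : ℝ) :=
        sum_le_sum fun _ _ => sum_le_sum fun _ _ =>
          prod_le_one (fun _ _ => prod_nonneg fun _ _ => h0 _ _)
            fun _ _ => prod_le_one (fun _ _ => h0 _ _) fun _ _ => h1 _ _
    _ = (Fintype.card X : ℝ) ^ k * (Sy.card : ℝ) ^ l := by
        simp [Fintype.card_piFinset]

/-- Counting grids by their first row. -/
theorem gridSum_succ [Fintype Y] (hA : ∀ x y, A x y = 0 ∨ A x y = 1) (k l : ℕ) :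
    gridSum univ (k + 1) l A = ∑ x, gridSum (univ.filter fun y => A x y = 1) k l A := by
  unfold gridSum
  simp only [Fintype.piFinset_univ]
  rw [← (Fin.consEquiv fun _ : Fin (k + 1) => X).sum_comp, Fintype.sum_prod_type]
  refine sum_congr rfl fun x _ => sum_congr rfl fun xs _ => ?_
  simp only [Fin.consEquiv_apply, Fin.prod_univ_succ, Fin.cons_zero, Fin.cons_succ]
  symm
  apply sum_subset_zero_on_sdiff (subset_univ _)
  · intro ys hys
    simp only [mem_sdiff, mem_univ, true_and, Fintype.mem_piFinset, mem_filter, not_forall] at hys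
    obtain ⟨j, hj⟩ := hys
    rw [prod_eq_zero (mem_univ j) ((hA x (ys j)).resolve_right hj), zero_mul]
  · intro ys hys
    simp only [Fintype.mem_piFinset, mem_filter, mem_univ, true_and] at hys
    simp [hys]

theorem le_gridNorm_iff (h0 : ∀ x y, 0 ≤ A x y) (Sy : Finset Y) {k l : ℕ} (hk : k ≠ 0)
    (hl : l ≠ 0) {c : ℝ} (hc : 0 ≤ c) :
    c ≤ gridNorm univ Sy k l A ↔
      c ^ (k * l) ≤ gridSum Sy k l A / ((Fintype.card X : ℝ) ^ k * (Sy.card : ℝ) ^ l) := by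
  have hkl : (0 : ℝ) < ((k * l : ℕ) : ℝ) := by positivity
  have hS := gridSum_nonneg h0 Sy k l
  rw [gridNorm, one_div, ← Nat.cast_mul, Real.le_rpow_inv_iff_of_pos hc _ hkl, Real.rpow_natCast]
  · rfl
  · exact div_nonneg hS (by positivity)

/-- A row whose degree is less than `δ` and which does not witness a large grid norm on its
neighbourhood contributes few grids. -/
theorem gridSum_neighbors_le [Nonempty X] [Fintype Y] [Nonempty Y]
    (hA : ∀ x y, A x y = 0 ∨ A x y = 1)
    {δ ε : ℝ} (hδ : 0 < δ) (hε : 0 < ε) {k l : ℕ} (hl : l ≠ 0) {x : X}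
    (hx : rowDeg univ A x < δ)
    (hno : k ≠ 0 → δ ^ (k + 1) ≤ rowDeg univ A x →
      gridNorm univ (univ.filter fun y => A x y = 1) k l A < (1 + ε) * δ) :
    gridSum (univ.filter fun y => A x y = 1) k l A ≤
      (1 + ε) ^ (k * l) * δ ^ ((k + 1) * l) *
        ((Fintype.card X : ℝ) ^ k * (Fintype.card Y : ℝ) ^ l) := by
  have h0 : ∀ x y, 0 ≤ A x y := fun x y => by rcases hA x y with h | h <;> simp [h]
  have h1 : ∀ x y, A x y ≤ 1 := fun x y => by rcases hA x y with h | h <;> simp [h]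
  have hY : (0 : ℝ) < Fintype.card Y := by exact_mod_cast Fintype.card_pos
  have hX : (0 : ℝ) < Fintype.card X := by exact_mod_cast Fintype.card_pos
  have hone : (1 : ℝ) ≤ (1 + ε) ^ (k * l) := one_le_pow₀ (by linarith)
  have hle := gridSum_le h0 h1 (univ.filter fun y => A x y = 1) k l
  rw [rowDeg_eq_card_div hA] at hx hno
  set Sy := univ.filter fun y => A x y = 1
  by_cases hlow : (Sy.card : ℝ) / Fintype.card Y < δ ^ (k + 1)
  · rw [div_lt_iff₀ hY] at hlow
    calc gridSum Sy k l A
        ≤ (Fintype.card X : ℝ) ^ k * (Sy.card : ℝ) ^ l := hle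
      _ ≤ (Fintype.card X : ℝ) ^ k * (δ ^ (k + 1) * Fintype.card Y) ^ l := by gcongr
      _ = 1 * (δ ^ ((k + 1) * l) * ((Fintype.card X : ℝ) ^ k * (Fintype.card Y : ℝ) ^ l)) := by
          rw [mul_pow, ← pow_mul]; ring
      _ ≤ (1 + ε) ^ (k * l) *
            (δ ^ ((k + 1) * l) * ((Fintype.card X : ℝ) ^ k * (Fintype.card Y : ℝ) ^ l)) := by
          gcongr
      _ = _ := by ring
  · have hhigh := not_lt.mp hlow
    have hk : k ≠ 0 := by
      rintro rfl
      simp only [zero_add, pow_one] at hhigh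
      exact absurd hx hhigh.not_gt
    have hSy : (0 : ℝ) < Sy.card :=
      (div_pos_iff_of_pos_right hY).mp ((pow_pos hδ _).trans_le hhigh)
    have hg := hno hk hhigh
    rw [← not_le, le_gridNorm_iff h0 _ hk hl (by positivity), not_le,
      div_lt_iff₀ (by positivity)] at hg
    rw [div_lt_iff₀ hY] at hx
    calc gridSum Sy k l A
        ≤ ((1 + ε) * δ) ^ (k * l) * ((Fintype.card X : ℝ) ^ k * (Sy.card : ℝ) ^ l) := hg.le
      _ ≤ ((1 + ε) * δ) ^ (k * l) *
            ((Fintype.card X : ℝ) ^ k * (δ * Fintype.card Y) ^ l) := by gcongr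
      _ = _ := by rw [mul_pow, mul_pow]; ring

end GridSum

/-- **Recursive sifting.** If `‖A‖_{U(k,ℓ)} ≥ (1+ε)δ` for a zero-one matrix `A`, then either
many rows have degree at least `δ`, or `k > 1` and there is a row `x` with `deg_A(x) ≥ δ^k`
whose neighborhood-restricted matrix `A_x = A[X, Y_x]` satisfies
`‖A_x‖_{U(k-1,ℓ)} ≥ (1+ε)δ`. -/
theorem sifting_recursion {X Y : Type*} [Fintype X] [Fintype Y] [Nonempty X] [Nonempty Y]
    (A : X → Y → ℝ) (hA : ZeroOne Finset.univ Finset.univ A)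
    (δ ε : ℝ) (hδ : 0 < δ) (hε : 0 < ε) (k l : ℕ) (hk : 1 ≤ k) (hl : 1 ≤ l)
    (hirr : (1 + ε) * δ ≤ gridNorm Finset.univ Finset.univ k l A) :
    (ε / 2 * δ ^ (k * l) * (Fintype.card X : ℝ)
        ≤ ((Finset.univ.filter (fun x : X => δ ≤ rowDeg Finset.univ A x)).card : ℝ)) ∨
    (1 < k ∧ ∃ x : X,
      δ ^ k ≤ rowDeg Finset.univ A x ∧
      (1 + ε) * δ ≤ gridNorm Finset.univ (Finset.univ.filter (fun y => A x y = 1)) (k - 1) l A) := by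
  have hA' : ∀ x y, A x y = 0 ∨ A x y = 1 := fun x y => hA x (mem_univ x) y (mem_univ y)
  have h0 : ∀ x y, 0 ≤ A x y := fun x y => by rcases hA' x y with h | h <;> simp [h]
  have h1 : ∀ x y, A x y ≤ 1 := fun x y => by rcases hA' x y with h | h <;> simp [h]
  have hl0 : l ≠ 0 := by omega
  obtain ⟨k, rfl⟩ : ∃ m, k = m + 1 := ⟨k - 1, by omega⟩
  rw [or_iff_not_imp_right]
  intro hno
  simp only [Nat.add_sub_cancel] at hno
  have hno' : ∀ x, k ≠ 0 → δ ^ (k + 1) ≤ rowDeg univ A x →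
      gridNorm univ (univ.filter fun y => A x y = 1) k l A < (1 + ε) * δ := fun x hk0 hx =>
    not_le.mp fun h => hno ⟨by omega, x, hx, h⟩
  have hY : (0 : ℝ) < Fintype.card Y := by exact_mod_cast Fintype.card_pos
  have hX : (0 : ℝ) < Fintype.card X := by exact_mod_cast Fintype.card_pos
  set D := univ.filter fun x : X => δ ≤ rowDeg univ A x
  set M : ℝ := (Fintype.card X : ℝ) ^ k * (Fintype.card Y : ℝ) ^ l with hM
  have hMpos : 0 < M := by positivity
  set c : ℝ := (1 + ε) ^ (k * l) * δ ^ ((k + 1) * l) with hc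
  have hcpos : 0 < c := by positivity
  rw [le_gridNorm_iff h0 _ (by omega) hl0 (by positivity), le_div_iff₀ (by positivity),
    gridSum_succ hA', card_univ] at hirr
  have hrow : ∀ x, gridSum (univ.filter fun y => A x y = 1) k l A ≤
      (if δ ≤ rowDeg univ A x then M else 0) + c * M := by
    intro x
    split_ifs with hx
    · have hle : gridSum (univ.filter fun y => A x y = 1) k l A ≤ M :=
        (gridSum_le h0 h1 _ k l).trans (by rw [hM]; gcongr; exact card_le_univ _)
      linarith [mul_pos hcpos hMpos]
    · rw [zero_add]
      exact gridSum_neighbors_le hA' hδ hε hl0 (not_le.mp hx) (hno' x)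
  have hsum := hirr.trans (sum_le_sum fun x _ => hrow x)
  rw [sum_add_distrib, ← sum_filter, sum_const, sum_const, card_univ, nsmul_eq_mul,
    nsmul_eq_mul] at hsum
  have hone : (1 : ℝ) ≤ (1 + ε) ^ (k * l) := one_le_pow₀ (by linarith)
  have hpow : 1 + ε ≤ (1 + ε) ^ l := le_self_pow₀ (by linarith) hl0
  have hdiv : (1 + ε) ^ l * c * Fintype.card X ≤ D.card + c * Fintype.card X := by
    refine le_of_mul_le_mul_right ?_ hMpos
    calc (1 + ε) ^ l * c * Fintype.card X * M
        = ((1 + ε) * δ) ^ ((k + 1) * l) *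
            ((Fintype.card X : ℝ) ^ (k + 1) * (Fintype.card Y : ℝ) ^ l) := by
          rw [hc, hM, mul_pow]; ring
      _ ≤ D.card * M + Fintype.card X * (c * M) := hsum
      _ = (D.card + c * Fintype.card X) * M := by ring
  have hcle : δ ^ ((k + 1) * l) ≤ c := le_mul_of_one_le_left (by positivity) hone
  calc ε / 2 * δ ^ ((k + 1) * l) * (Fintype.card X : ℝ)
      ≤ ε * c * Fintype.card X := by gcongr; linarith
    _ = (1 + ε) * c * Fintype.card X - c * Fintype.card X := by ring
    _ ≤ (1 + ε) ^ l * c * Fintype.card X - c * Fintype.card X := by gcongr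
    _ ≤ D.card := by linarith
end

section
/- Let X and Y be finite nonempty sets, let A ∈ {0,1}^{X×Y}, let ε > 0 and let k, ℓ ≥ 1 be integers. Then either A is (ε,k,ℓ)-regular, or there exist nonempty sets X' ⊆ X and Y' ⊆ Y such that |X'|·|Y'| ≥ (ε/16)·E[A]^{kℓ}·|X|·|Y| and E[A[X',Y']] ≥ (1 + ε/2)·E[A]. -/
open Finset

/-- The count, weighted by `A`, of homomorphic copies of the bipartite graph with edge set `S`. -/
noncomputable def edgeCount {X Y ι κ : Type*} [Fintype X] [Fintype Y] [Fintype ι] [Fintype κ]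
    [DecidableEq ι] [DecidableEq κ] (A : X → Y → ℝ) (S : Finset (ι × κ)) : ℝ :=
  ∑ xs : ι → X, ∑ ys : κ → Y, ∏ e ∈ S, A (xs e.1) (ys e.2)

/-- Resampling one coordinate of a uniformly random function does not change averages. -/
lemma sum_sum_update {X ι : Type*} [Fintype X] [Fintype ι] [DecidableEq ι] (i : ι)
    (f : (ι → X) → ℝ) :
    ∑ xs : ι → X, ∑ x : X, f (Function.update xs i x)
      = (Fintype.card X : ℝ) * ∑ xs : ι → X, f xs := by
  have hinv : Function.Involutive
      (fun p : (ι → X) × X => (Function.update p.1 i p.2, p.1 i)) := by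
    rintro ⟨xs, x⟩
    simp
  have h := Equiv.sum_comp hinv.toPerm (fun p : (ι → X) × X => f p.1)
  rw [Fintype.sum_prod_type, Fintype.sum_prod_type] at h
  simpa [Function.Involutive.toPerm, ← mul_sum] using h

/-- Resampling one coordinate on each side of a pair of uniformly random functions. -/
lemma sum_sum_update_update {X Y ι κ : Type*} [Fintype X] [Fintype Y] [Fintype ι] [Fintype κ]
    [DecidableEq ι] [DecidableEq κ] (i : ι) (j : κ) (f : (ι → X) → (κ → Y) → ℝ) :
    ∑ xs : ι → X, ∑ ys : κ → Y, ∑ x : X, ∑ y : Y,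
        f (Function.update xs i x) (Function.update ys j y)
      = (Fintype.card X : ℝ) * (Fintype.card Y : ℝ) * ∑ xs : ι → X, ∑ ys : κ → Y, f xs ys := by
  have h : ∀ xs : ι → X, ∑ ys : κ → Y, ∑ x : X, ∑ y : Y,
      f (Function.update xs i x) (Function.update ys j y)
      = ∑ x : X, (Fintype.card Y : ℝ) * ∑ ys : κ → Y, f (Function.update xs i x) ys := by
    intro xs
    rw [sum_comm]
    exact sum_congr rfl fun x _ => sum_sum_update j (f (Function.update xs i x))
  simp_rw [h]
  rw [sum_sum_update i (fun xs => (Fintype.card Y : ℝ) * ∑ ys : κ → Y, f xs ys), ← mul_sum]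
  ring

lemma exists_edge_ratio_ge {E : Type*} [Fintype E] [DecidableEq E] (F : Finset E → ℝ) (c : ℝ)
    (hc : 0 ≤ c) (h : c ^ Fintype.card E * F ∅ < F univ) :
    ∃ (S : Finset E) (e : E), e ∉ S ∧ c * F S ≤ F (insert e S) := by
  by_contra! hcon
  have key : ∀ S : Finset E, F S ≤ c ^ S.card * F ∅ := by
    intro S
    induction S using Finset.induction_on with
    | empty => simp
    | insert e S he ih =>
      rw [card_insert_of_notMem he, pow_succ']
      calc F (insert e S) ≤ c * F S := (hcon S e he).le
        _ ≤ c * (c ^ S.card * F ∅) := mul_le_mul_of_nonneg_left ih hc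
        _ = c * c ^ S.card * F ∅ := by ring
  have := key univ
  rw [card_univ] at this
  linarith

lemma prod_eq_zero_or_one {E : Type*} (S : Finset E) (f : E → ℝ)
    (hf : ∀ e ∈ S, f e = 0 ∨ f e = 1) : ∏ e ∈ S, f e = 0 ∨ ∏ e ∈ S, f e = 1 := by
  by_cases h : ∃ e ∈ S, f e = 0
  · obtain ⟨e, he, h0⟩ := h
    exact Or.inl (prod_eq_zero he h0)
  · push Not at h
    exact Or.inr (prod_eq_one fun e he => (hf e he).resolve_left (h e he))

/-- A zero-one weight of product form is the indicator of a rectangle. -/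
lemma exists_rectangle_of_weighted_sum {X Y : Type*} [Fintype X] [Fintype Y]
    (B : X → Y → ℝ) (u : X → ℝ) (v : Y → ℝ) (r δ : ℝ)
    (hu : ∀ x, u x = 0 ∨ u x = 1) (hv : ∀ y, v y = 0 ∨ v y = 1) (hr : r = 0 ∨ r = 1)
    (hδ : 0 < δ) (h : δ ≤ ∑ x, ∑ y, B x y * (u x * v y * r)) :
    ∃ (X' : Finset X) (Y' : Finset Y), δ ≤ ∑ x ∈ X', ∑ y ∈ Y', B x y := by
  classical
  rcases hr with rfl | rfl
  · simp at h
    linarith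
  refine ⟨univ.filter (fun x => u x = 1), univ.filter (fun y => v y = 1), h.trans_eq ?_⟩
  rw [sum_filter]
  refine sum_congr rfl fun x _ => ?_
  rcases hu x with hx | hx
  · simp [hx]
  · rw [sum_filter, if_pos hx]
    refine sum_congr rfl fun y _ => ?_
    rcases hv y with hy | hy <;> simp [hx, hy]

lemma exists_rectangle_of_edgeCount {X Y ι κ : Type*} [Fintype X] [Fintype Y] [Fintype ι]
    [Fintype κ] [Nonempty X] [Nonempty Y] [DecidableEq ι] [DecidableEq κ] (A : X → Y → ℝ)
    (hA : ∀ x y, A x y = 0 ∨ A x y = 1) (S : Finset (ι × κ)) (e : ι × κ) (he : e ∉ S)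
    (c δ : ℝ) (hδ : 0 < δ)
    (h : δ * ((Fintype.card X : ℝ) ^ Fintype.card ι * (Fintype.card Y : ℝ) ^ Fintype.card κ)
      ≤ edgeCount A (insert e S) - c * edgeCount A S) :
    ∃ (X' : Finset X) (Y' : Finset Y),
      δ * ((Fintype.card X : ℝ) * (Fintype.card Y : ℝ)) ≤ ∑ x ∈ X', ∑ y ∈ Y', (A x y - c) := by
  obtain ⟨i, j⟩ := e
  have hX : (0 : ℝ) < Fintype.card X := by exact_mod_cast Fintype.card_pos
  have hY : (0 : ℝ) < Fintype.card Y := by exact_mod_cast Fintype.card_pos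
  have hdiff : edgeCount A (insert (i, j) S) - c * edgeCount A S
      = ∑ xs : ι → X, ∑ ys : κ → Y,
        (A (xs i) (ys j) - c) * ∏ e ∈ S, A (xs e.1) (ys e.2) := by
    simp only [edgeCount, mul_sum, ← sum_sub_distrib, prod_insert he, sub_mul]
  have hsum := sum_sum_update_update i j (fun (xs : ι → X) (ys : κ → Y) =>
    (A (xs i) (ys j) - c) * ∏ e ∈ S, A (xs e.1) (ys e.2))
  rw [← hdiff] at hsum
  obtain ⟨xs, ys, hxy⟩ : ∃ (xs : ι → X) (ys : κ → Y),
      δ * ((Fintype.card X : ℝ) * (Fintype.card Y : ℝ)) ≤ ∑ x : X, ∑ y : Y,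
        (A (Function.update xs i x i) (Function.update ys j y j) - c)
          * ∏ e ∈ S, A (Function.update xs i x e.1) (Function.update ys j y e.2) := by
    by_contra! hcon
    have hlt := sum_lt_sum_of_nonempty (univ_nonempty (α := ι → X)) fun xs _ =>
      sum_lt_sum_of_nonempty (univ_nonempty (α := κ → Y)) fun ys _ => hcon xs ys
    rw [hsum] at hlt
    simp only [sum_const, card_univ, Fintype.card_fun, nsmul_eq_mul, Nat.cast_pow] at hlt
    have := mul_le_mul_of_nonneg_left h (mul_pos hX hY).le
    linarith
  refine exists_rectangle_of_weighted_sum (fun x y => A x y - c)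
    (fun x => ∏ e ∈ S, if e.1 = i then A x (ys e.2) else 1)
    (fun y => ∏ e ∈ S, if e.2 = j then A (xs e.1) y else 1)
    (∏ e ∈ S, if e.1 = i ∨ e.2 = j then 1 else A (xs e.1) (ys e.2))
    (δ * ((Fintype.card X : ℝ) * (Fintype.card Y : ℝ))) ?_ ?_ ?_ (by positivity) ?_
  · intro x
    refine prod_eq_zero_or_one S _ fun e _ => ?_
    split_ifs
    exacts [hA _ _, Or.inr rfl]
  · intro y
    refine prod_eq_zero_or_one S _ fun e _ => ?_
    split_ifs
    exacts [hA _ _, Or.inr rfl]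
  · refine prod_eq_zero_or_one S _ fun e _ => ?_
    split_ifs
    exacts [Or.inr rfl, hA _ _]
  · refine hxy.trans_eq (sum_congr rfl fun x _ => sum_congr rfl fun y _ => ?_)
    simp only [Function.update_self]
    congr 1
    rw [← prod_mul_distrib, ← prod_mul_distrib]
    refine prod_congr rfl fun e heS => ?_
    by_cases h1 : e.1 = i <;> by_cases h2 : e.2 = j
    · exact absurd (by rwa [← h1, ← h2]) he
    all_goals simp [h1, h2]

lemma edgeCount_anti {X Y ι κ : Type*} [Fintype X] [Fintype Y] [Fintype ι] [Fintype κ]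
    [DecidableEq ι] [DecidableEq κ] (A : X → Y → ℝ) (hA : ∀ x y, A x y = 0 ∨ A x y = 1)
    {S T : Finset (ι × κ)} (h : S ⊆ T) : edgeCount A T ≤ edgeCount A S := by
  refine sum_le_sum fun xs _ => sum_le_sum fun ys _ => ?_
  rw [← prod_sdiff h]
  refine mul_le_of_le_one_left ?_ ?_
  · rcases prod_eq_zero_or_one S _ (fun e _ => hA (xs e.1) (ys e.2)) with h | h <;> simp [h]
  · rcases prod_eq_zero_or_one (T \ S) _ (fun e _ => hA (xs e.1) (ys e.2)) with h | h <;> simp [h]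

lemma pow_lt_of_not_gridRegular {X Y : Type*} [Fintype X] [Fintype Y] [Nonempty X] [Nonempty Y]
    (A : X → Y → ℝ) (hA : ∀ x y, 0 ≤ A x y) {ε : ℝ} (hε : 0 < ε) {k l : ℕ}
    (hk : 1 ≤ k) (hl : 1 ≤ l) (h : ¬ GridRegular univ univ ε k l A) :
    ((1 + ε) * density univ univ A) ^ (k * l)
        * ((Fintype.card X : ℝ) ^ k * (Fintype.card Y : ℝ) ^ l)
      < edgeCount A (univ : Finset (Fin k × Fin l)) := by
  have hX : (0 : ℝ) < Fintype.card X := by exact_mod_cast Fintype.card_pos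
  have hY : (0 : ℝ) < Fintype.card Y := by exact_mod_cast Fintype.card_pos
  have hp : 0 ≤ density univ univ A :=
    div_nonneg (sum_nonneg fun x _ => sum_nonneg fun y _ => hA x y) (by positivity)
  have hcount : edgeCount A (univ : Finset (Fin k × Fin l)) =
      ∑ xs : Fin k → X, ∑ ys : Fin l → Y, ∏ i, ∏ j, A (xs i) (ys j) := by
    simp only [edgeCount, Fintype.prod_prod_type]
  have hcount0 : 0 ≤ edgeCount A (univ : Finset (Fin k × Fin l)) :=
    sum_nonneg fun xs _ => sum_nonneg fun ys _ => prod_nonneg fun e _ => hA _ _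
  by_contra! hle
  apply h
  rw [GridRegular, gridNorm, Fintype.piFinset_univ, Fintype.piFinset_univ, ← hcount]
  simp only [card_univ]
  rw [← div_le_iff₀ (by positivity)] at hle
  calc _ ≤ (((1 + ε) * density univ univ A) ^ (k * l)) ^ ((1 : ℝ) / (k * l)) :=
        Real.rpow_le_rpow (by positivity) hle (by positivity)
    _ = (1 + ε) * density univ univ A := by
        rw [one_div, ← Nat.cast_mul]
        exact Real.pow_rpow_inv_natCast (by positivity) (Nat.mul_pos hk hl).ne'

/-- **Sifting (existential content).** For a zero-one matrix `A` on finite nonempty `X × Y`,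
`ε > 0` and integers `k, ℓ ≥ 1`: either `A` is `(ε,k,ℓ)`-regular, or there are nonempty
`X' ⊆ X`, `Y' ⊆ Y` with `|X'||Y'| ≥ (ε/16)·E[A]^{kℓ}·|X||Y|` and
`E[A[X',Y']] ≥ (1 + ε/2)·E[A]`. -/
theorem sifting {X Y : Type*} [Fintype X] [Fintype Y] [Nonempty X] [Nonempty Y]
    (A : X → Y → ℝ) (hA : ZeroOne Finset.univ Finset.univ A)
    (ε : ℝ) (hε : 0 < ε) (k l : ℕ) (hk : 1 ≤ k) (hl : 1 ≤ l) :
    GridRegular Finset.univ Finset.univ ε k l A ∨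
    ∃ (X' : Finset X) (Y' : Finset Y), X'.Nonempty ∧ Y'.Nonempty ∧
      ε / 16 * density Finset.univ Finset.univ A ^ (k * l)
          * ((Fintype.card X : ℝ) * (Fintype.card Y : ℝ))
        ≤ (X'.card : ℝ) * (Y'.card : ℝ) ∧
      (1 + ε / 2) * density Finset.univ Finset.univ A ≤ density X' Y' A := by
  have hA' : ∀ x y, A x y = 0 ∨ A x y = 1 := fun x y => hA x (mem_univ x) y (mem_univ y)
  have hA0 : ∀ x y, 0 ≤ A x y := fun x y => by rcases hA' x y with h | h <;> simp [h]
  have hA1 : ∀ x y, A x y ≤ 1 := fun x y => by rcases hA' x y with h | h <;> simp [h]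
  have hX : (0 : ℝ) < Fintype.card X := by exact_mod_cast Fintype.card_pos
  have hY : (0 : ℝ) < Fintype.card Y := by exact_mod_cast Fintype.card_pos
  rw [or_iff_not_imp_left]
  intro hreg
  have hlt := pow_lt_of_not_gridRegular A hA0 hε hk hl hreg
  set p := density univ univ A with hpdef
  have hp0 : 0 ≤ p :=
    div_nonneg (sum_nonneg fun x _ => sum_nonneg fun y _ => hA0 x y) (by positivity)
  have hkl : k * l ≠ 0 := (Nat.mul_pos hk hl).ne'
  have hp : 0 < p := by
    refine hp0.lt_of_ne fun hzero => hreg ?_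
    have hsum : ∑ x, ∑ y, A x y = 0 := by
      have := hzero.symm
      rw [hpdef, density, div_eq_zero_iff] at this
      refine this.resolve_right ?_
      simp only [card_univ]
      positivity
    have hAz : ∀ x y, A x y = 0 := by
      intro x y
      have h1 := (sum_eq_zero_iff_of_nonneg
        (fun x _ => sum_nonneg fun y _ => hA0 x y)).1 hsum x (mem_univ x)
      exact (sum_eq_zero_iff_of_nonneg (fun y _ => hA0 x y)).1 h1 y (mem_univ y)
    have hk' : k ≠ 0 := by omega
    have hl' : l ≠ 0 := by omega
    rw [GridRegular, ← hpdef, ← hzero]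
    simp [gridNorm, hAz, hk', hl']
  set V := (Fintype.card X : ℝ) ^ k * (Fintype.card Y : ℝ) ^ l with hV
  have hVpos : 0 < V := by positivity
  have hempty : edgeCount A (∅ : Finset (Fin k × Fin l)) = V := by simp [edgeCount, hV]
  obtain ⟨S, e, he, hS⟩ := exists_edge_ratio_ge
    (edgeCount A : Finset (Fin k × Fin l) → ℝ) ((1 + ε) * p) (by positivity)
    (by simpa [hempty] using hlt)
  have hT : ((1 + ε) * p) ^ (k * l) * V ≤ edgeCount A (insert e S) :=
    hlt.le.trans (edgeCount_anti A hA' (subset_univ _))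
  have hpow : (1 + ε) * (p ^ (k * l) * V) ≤ edgeCount A (insert e S) := by
    refine le_trans ?_ hT
    rw [mul_pow, mul_assoc]
    gcongr
    exact le_self_pow₀ (by linarith) hkl
  have hgap : ε / 2 * p ^ (k * l) * V
      ≤ edgeCount A (insert e S) - (1 + ε / 2) * p * edgeCount A S := by
    refine le_of_mul_le_mul_left ?_ (show 0 < 1 + ε by linarith)
    have h1 := mul_le_mul_of_nonneg_left hpow (show 0 ≤ ε / 2 by linarith)
    have h2 := mul_le_mul_of_nonneg_left hS (show 0 ≤ 1 + ε / 2 by linarith)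
    linarith
  obtain ⟨X', Y', hXY⟩ := exists_rectangle_of_edgeCount A hA' S e he ((1 + ε / 2) * p)
    (ε / 2 * p ^ (k * l)) (by positivity) (by simpa [hV] using hgap)
  have hcard : ∑ x ∈ X', ∑ y ∈ Y', (A x y - (1 + ε / 2) * p)
      = ∑ x ∈ X', ∑ y ∈ Y', A x y - (1 + ε / 2) * p * (X'.card * Y'.card) := by
    simp only [sum_sub_distrib, sum_const, nsmul_eq_mul]
    ring
  rw [hcard] at hXY
  have hle : ∑ x ∈ X', ∑ y ∈ Y', A x y ≤ (X'.card : ℝ) * Y'.card := by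
    calc ∑ x ∈ X', ∑ y ∈ Y', A x y ≤ ∑ x ∈ X', ∑ y ∈ Y', (1 : ℝ) :=
          sum_le_sum fun x _ => sum_le_sum fun y _ => hA1 x y
      _ = (X'.card : ℝ) * Y'.card := by simp
  have hδ : 0 < p ^ (k * l) * ((Fintype.card X : ℝ) * (Fintype.card Y : ℝ)) := by positivity
  have hεδ := mul_pos hε hδ
  have hnonneg : 0 ≤ (1 + ε / 2) * p * ((X'.card : ℝ) * Y'.card) := by positivity
  have hpos : 0 < (X'.card : ℝ) * Y'.card := by linarith
  refine ⟨X', Y', ?_, ?_, by linarith, ?_⟩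
  · rw [nonempty_iff_ne_empty]
    rintro rfl
    simp at hpos
  · rw [nonempty_iff_ne_empty]
    rintro rfl
    simp at hpos
  · rw [density, le_div_iff₀ hpos]
    linarith
end

section
/- Let X and Y be finite nonempty sets, let A ∈ {0,1}^{X×Y}, let δ, ε > 0 and let k, ℓ ≥ 1 be integers. Let 𝒮 be a finite nonempty family of nonempty subsets S ⊆ X such that for every function f : X → [0,1], the fraction of S ∈ 𝒮 satisfying |E_{x∈X} f(x) − E_{x∈S} f(x)| ≤ ε is at least 1 − δ; and let 𝒯 be a finite nonempty family of nonempty subsets T ⊆ Y with the analogous property for functions g : Y → [0,1]. Then | ‖A‖_{U(k,ℓ)}^{kℓ} − E_{S∈𝒮, T∈𝒯} ‖A[S,T]‖_{U(k,ℓ)}^{kℓ} | ≤ 2εk + 2εℓ + 2δ. -/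
open Finset

open scoped Classical

/-- The average of a `[0,1]`-valued function over a nonempty set lies in `[0,1]`. -/
lemma sum_div_card_mem_Icc {X : Type*} {S : Finset X} {f : X → ℝ}
    (hf : ∀ x, f x ∈ Set.Icc (0 : ℝ) 1) :
    (∑ x ∈ S, f x) / (S.card : ℝ) ∈ Set.Icc (0 : ℝ) 1 := by
  refine ⟨div_nonneg (sum_nonneg fun x _ => (hf x).1) (Nat.cast_nonneg _),
    div_le_one_of_le₀ ?_ (Nat.cast_nonneg _)⟩
  calc ∑ x ∈ S, f x ≤ ∑ _x ∈ S, (1 : ℝ) := sum_le_sum fun x _ => (hf x).2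
    _ = S.card := by simp

/-- Taking powers is `k`-Lipschitz on the unit interval. -/
lemma abs_pow_sub_pow_le_of_mem_Icc {a b : ℝ} (ha : a ∈ Set.Icc (0 : ℝ) 1)
    (hb : b ∈ Set.Icc (0 : ℝ) 1) (k : ℕ) : |a ^ k - b ^ k| ≤ k * |a - b| := by
  have hmax : max |a| |b| ^ (k - 1) ≤ 1 := by
    refine pow_le_one₀ (le_max_of_le_left (abs_nonneg a)) (max_le ?_ ?_)
    · rw [abs_of_nonneg ha.1]; exact ha.2
    · rw [abs_of_nonneg hb.1]; exact hb.2
  calc |a ^ k - b ^ k| ≤ |a - b| * k * max |a| |b| ^ (k - 1) := abs_pow_sub_pow_le a b k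
    _ ≤ |a - b| * k * 1 := by gcongr
    _ = k * |a - b| := by ring

/-- A bound on the difference between a constant and an average follows from a termwise bound. -/
lemma abs_sub_sum_div_card_le {ι : Type*} {s : Finset ι} (hs : s.Nonempty) (a c : ℝ) (u : ι → ℝ)
    (h : ∑ i ∈ s, |a - u i| ≤ c * s.card) : |a - (∑ i ∈ s, u i) / (s.card : ℝ)| ≤ c := by
  have hpos : (0 : ℝ) < s.card := by exact_mod_cast hs.card_pos
  have heq : a - (∑ i ∈ s, u i) / (s.card : ℝ) = (∑ i ∈ s, (a - u i)) / s.card := by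
    rw [sum_sub_distrib, sum_const, nsmul_eq_mul]
    field_simp
  rw [heq, abs_div, abs_of_pos hpos, div_le_iff₀ hpos]
  exact (abs_sum_le_sum_abs _ _).trans h

/-- The average of `∏_{i,j} A(x_i, y_j)` over all tuples in `Sx` and `Sy`. -/
noncomputable def gridAverage {X Y : Type*} (Sx : Finset X) (Sy : Finset Y) (k l : ℕ)
    (A : X → Y → ℝ) : ℝ :=
  (∑ xs ∈ Fintype.piFinset (fun _ : Fin k => Sx),
      ∑ ys ∈ Fintype.piFinset (fun _ : Fin l => Sy),
      ∏ i : Fin k, ∏ j : Fin l, A (xs i) (ys j)) /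
    ((Sx.card : ℝ) ^ k * (Sy.card : ℝ) ^ l)

lemma gridNorm_pow {X Y : Type*} (Sx : Finset X) (Sy : Finset Y) {k l : ℕ} (hk : 1 ≤ k)
    (hl : 1 ≤ l) {A : X → Y → ℝ} (hA : ∀ x y, 0 ≤ A x y) :
    gridNorm Sx Sy k l A ^ (k * l) = gridAverage Sx Sy k l A := by
  have hnonneg : 0 ≤ gridAverage Sx Sy k l A :=
    div_nonneg (sum_nonneg fun _ _ => sum_nonneg fun _ _ => prod_nonneg fun _ _ =>
      prod_nonneg fun _ _ => hA _ _) (by positivity)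
  have hkl : k * l ≠ 0 := Nat.mul_ne_zero (by omega) (by omega)
  have h := Real.rpow_inv_natCast_pow hnonneg hkl
  rw [Nat.cast_mul, ← one_div] at h
  exact h

lemma gridAverage_swap {X Y : Type*} (Sx : Finset X) (Sy : Finset Y) (k l : ℕ)
    (A : X → Y → ℝ) :
    gridAverage Sy Sx l k (fun y x => A x y) = gridAverage Sx Sy k l A := by
  unfold gridAverage
  rw [sum_comm, mul_comm]
  congr 1
  refine sum_congr rfl fun xs _ => sum_congr rfl fun ys _ => ?_
  exact prod_comm

/-- The grid average is the average over column tuples of the `k`-th power of the codegree. -/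
lemma gridAverage_eq_sum_pow {X Y : Type*} (Sx : Finset X) (Sy : Finset Y) (k l : ℕ)
    (A : X → Y → ℝ) :
    gridAverage Sx Sy k l A =
      (∑ ys ∈ Fintype.piFinset (fun _ : Fin l => Sy),
        ((∑ x ∈ Sx, ∏ j : Fin l, A x (ys j)) / (Sx.card : ℝ)) ^ k) /
      ((Fintype.piFinset (fun _ : Fin l => Sy)).card : ℝ) := by
  unfold gridAverage
  rw [sum_comm, Fintype.card_piFinset_const, Nat.cast_pow, ← div_div, sum_div]
  congr 1
  refine sum_congr rfl fun ys _ => ?_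
  rw [div_pow, sum_pow']

/-- A sampler for averages of `[0,1]`-valued functions also samples powers of averages. -/
lemma sampler_pow {X : Type*} [Fintype X] {δ ε : ℝ} (hε : 0 < ε) (k : ℕ)
    {𝒮 : Finset (Finset X)} (hne : 𝒮.Nonempty) {f : X → ℝ} (hf : ∀ x, f x ∈ Set.Icc (0 : ℝ) 1)
    (h𝒮 : (1 - δ) * (𝒮.card : ℝ) ≤
        ((𝒮.filter (fun S =>
          |(∑ x : X, f x) / (Fintype.card X : ℝ) - (∑ x ∈ S, f x) / (S.card : ℝ)| ≤ ε)).card : ℝ)) :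
    |((∑ x : X, f x) / (Fintype.card X : ℝ)) ^ k
        - (∑ S ∈ 𝒮, ((∑ x ∈ S, f x) / (S.card : ℝ)) ^ k) / (𝒮.card : ℝ)| ≤ ε * k + δ := by
  refine abs_sub_sum_div_card_le hne _ _ _ ?_
  have hmean : (∑ x : X, f x) / (Fintype.card X : ℝ) ∈ Set.Icc (0 : ℝ) 1 :=
    sum_div_card_mem_Icc (S := univ) hf
  set a := (∑ x : X, f x) / (Fintype.card X : ℝ)
  set p : Finset X → Prop := fun S => |a - (∑ x ∈ S, f x) / (S.card : ℝ)| ≤ ε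
  have hterm : ∀ S ∈ 𝒮, |a ^ k - ((∑ x ∈ S, f x) / (S.card : ℝ)) ^ k|
      ≤ ε * k + (1 - if p S then (1 : ℝ) else 0) := by
    intro S _
    have hS : (∑ x ∈ S, f x) / (S.card : ℝ) ∈ Set.Icc (0 : ℝ) 1 := sum_div_card_mem_Icc hf
    by_cases hp : p S
    · have hp' : |a - (∑ x ∈ S, f x) / (S.card : ℝ)| ≤ ε := hp
      have hlip := abs_pow_sub_pow_le_of_mem_Icc hmean hS k
      have hmul := mul_le_mul_of_nonneg_left hp' (Nat.cast_nonneg (α := ℝ) k)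
      rw [if_pos hp]
      linarith
    · have hak := pow_nonneg hmean.1 k
      have hak' := pow_le_one₀ (n := k) hmean.1 hmean.2
      have hbk := pow_nonneg hS.1 k
      have hbk' := pow_le_one₀ (n := k) hS.1 hS.2
      have hεk : 0 ≤ ε * k := by positivity
      rw [if_neg hp, abs_le]
      constructor <;> linarith
  refine (sum_le_sum hterm).trans ?_
  rw [sum_add_distrib, sum_sub_distrib, sum_boole, sum_const, sum_const, nsmul_eq_mul,
    nsmul_eq_mul]
  linarith

/-- Sampling the rows changes the grid average by at most `εk + δ` on average. -/
lemma gridAverage_sampling {X Y : Type*} [Fintype X] {A : X → Y → ℝ}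
    (hA : ∀ x y, A x y ∈ Set.Icc (0 : ℝ) 1) {δ ε : ℝ} (hε : 0 < ε) (k l : ℕ)
    {𝒮 : Finset (Finset X)} (hne : 𝒮.Nonempty)
    (h𝒮 : ∀ f : X → ℝ, (∀ x, f x ∈ Set.Icc (0 : ℝ) 1) →
      (1 - δ) * (𝒮.card : ℝ) ≤
        ((𝒮.filter (fun S =>
          |(∑ x : X, f x) / (Fintype.card X : ℝ) - (∑ x ∈ S, f x) / (S.card : ℝ)| ≤ ε)).card : ℝ))
    {T : Finset Y} (hT : T.Nonempty) :
    |gridAverage univ T k l A - (∑ S ∈ 𝒮, gridAverage S T k l A) / (𝒮.card : ℝ)|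
      ≤ ε * k + δ := by
  simp only [gridAverage_eq_sum_pow]
  set P := Fintype.piFinset (fun _ : Fin l => T)
  have hP : P.Nonempty := Fintype.piFinset_nonempty.2 fun _ => hT
  have hpos : (0 : ℝ) < P.card := by exact_mod_cast hP.card_pos
  rw [← sum_div, sum_comm, div_right_comm, ← sub_div, sum_div, ← sum_sub_distrib, abs_div,
    abs_of_pos hpos, div_le_iff₀ hpos]
  refine (abs_sum_le_sum_abs _ _).trans ?_
  rw [mul_comm, ← nsmul_eq_mul]
  refine sum_le_card_nsmul _ _ _ fun ys _ => ?_
  have hf : ∀ x, ∏ j : Fin l, A x (ys j) ∈ Set.Icc (0 : ℝ) 1 := fun x =>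
    ⟨prod_nonneg fun j _ => (hA x (ys j)).1,
      prod_le_one (fun j _ => (hA x (ys j)).1) fun j _ => (hA x (ys j)).2⟩
  exact sampler_pow hε k hne hf (h𝒮 _ hf)

/-- **Regularity approximation via oblivious sampling.** If `𝒮` and `𝒯` are `(ε,δ)`-oblivious
samplers of `X` and `Y` (i.e., for every `[0,1]`-valued function, at least a `(1−δ)`-fraction
of the sample sets estimate its average up to additive error `ε`), then the average of
`‖A[S,T]‖_{U(k,ℓ)}^{kℓ}` over `S ∈ 𝒮, T ∈ 𝒯` approximates `‖A‖_{U(k,ℓ)}^{kℓ}` up to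
`2εk + 2εℓ + 2δ`. -/
theorem grid_norm_sampling {X Y : Type*} [Fintype X] [Fintype Y] [Nonempty X] [Nonempty Y]
    (A : X → Y → ℝ) (hA : ZeroOne Finset.univ Finset.univ A)
    (δ ε : ℝ) (hδ : 0 < δ) (hε : 0 < ε) (k l : ℕ) (hk : 1 ≤ k) (hl : 1 ≤ l)
    (𝒮 : Finset (Finset X)) (𝒯 : Finset (Finset Y))
    (h𝒮ne : 𝒮.Nonempty) (h𝒯ne : 𝒯.Nonempty)
    (h𝒮mem : ∀ S ∈ 𝒮, S.Nonempty) (h𝒯mem : ∀ T ∈ 𝒯, T.Nonempty)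
    (h𝒮 : ∀ f : X → ℝ, (∀ x, f x ∈ Set.Icc (0 : ℝ) 1) →
      (1 - δ) * (𝒮.card : ℝ) ≤
        ((𝒮.filter (fun S =>
          |(∑ x : X, f x) / (Fintype.card X : ℝ) - (∑ x ∈ S, f x) / (S.card : ℝ)| ≤ ε)).card : ℝ))
    (h𝒯 : ∀ g : Y → ℝ, (∀ y, g y ∈ Set.Icc (0 : ℝ) 1) →
      (1 - δ) * (𝒯.card : ℝ) ≤
        ((𝒯.filter (fun T =>
          |(∑ y : Y, g y) / (Fintype.card Y : ℝ) - (∑ y ∈ T, g y) / (T.card : ℝ)| ≤ ε)).card : ℝ)) :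
    |gridNorm Finset.univ Finset.univ k l A ^ (k * l)
        - (∑ S ∈ 𝒮, ∑ T ∈ 𝒯, gridNorm S T k l A ^ (k * l)) / ((𝒮.card : ℝ) * (𝒯.card : ℝ))|
      ≤ 2 * ε * k + 2 * ε * l + 2 * δ := by
  have hA01 : ∀ x y, A x y ∈ Set.Icc (0 : ℝ) 1 := by
    intro x y
    rcases hA x (mem_univ x) y (mem_univ y) with h | h <;> simp [h]
  simp only [gridNorm_pow _ _ hk hl fun x y => (hA01 x y).1]
  have hrows := gridAverage_sampling hA01 hε k l h𝒮ne h𝒮 (univ_nonempty (α := Y))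
  have hcols : ∀ S ∈ 𝒮, |gridAverage S univ k l A
      - (∑ T ∈ 𝒯, gridAverage S T k l A) / (𝒯.card : ℝ)| ≤ ε * l + δ := by
    intro S hS
    have h := gridAverage_sampling (A := fun y x => A x y) (fun y x => hA01 x y) hε l k h𝒯ne h𝒯
      (h𝒮mem S hS)
    simpa only [gridAverage_swap] using h
  have hpos : (0 : ℝ) < 𝒮.card := by exact_mod_cast h𝒮ne.card_pos
  have hmid : |(∑ S ∈ 𝒮, gridAverage S univ k l A) / (𝒮.card : ℝ)
      - (∑ S ∈ 𝒮, ∑ T ∈ 𝒯, gridAverage S T k l A) / ((𝒮.card : ℝ) * (𝒯.card : ℝ))|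
      ≤ ε * l + δ := by
    rw [mul_comm (𝒮.card : ℝ), ← div_div, ← sub_div, sum_div, ← sum_sub_distrib, abs_div,
      abs_of_pos hpos, div_le_iff₀ hpos]
    refine (abs_sum_le_sum_abs _ _).trans ?_
    rw [mul_comm, ← nsmul_eq_mul]
    exact sum_le_card_nsmul _ _ _ hcols
  have htri := abs_sub_le (gridAverage univ univ k l A)
    ((∑ S ∈ 𝒮, gridAverage S univ k l A) / (𝒮.card : ℝ))
    ((∑ S ∈ 𝒮, ∑ T ∈ 𝒯, gridAverage S T k l A) / ((𝒮.card : ℝ) * (𝒯.card : ℝ)))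
  have hεk : 0 ≤ ε * k := by positivity
  have hεl : 0 ≤ ε * l := by positivity
  linarith
end

section
/- Let X and Y be finite nonempty sets, let A ∈ {0,1}^{X×Y}, and let ε > 0 and γ ∈ (0,1). Then there exists a nonempty set X' ⊆ X with |X'| ≥ ⌊(1−γ)·|X|⌋ such that, writing A' = A[X',Y], one of the following holds: (1) A' is ε-min-degree and E[A'] ≥ E[A]; or (2) E[A'] ≥ (1 + γε)·E[A]. -/
open Finset

theorem card_mul_density {X Y : Type*} (Sx : Finset X) (Sy : Finset Y) (A : X → Y → ℝ) :
    (Sx.card : ℝ) * density Sx Sy A = ∑ x ∈ Sx, rowDeg Sy A x := by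
  rcases Sx.eq_empty_or_nonempty with rfl | hS
  · simp
  have hc : (Sx.card : ℝ) ≠ 0 := by exact_mod_cast hS.card_pos.ne'
  simp only [rowDeg, density]
  rw [← Finset.sum_div, ← div_div, div_right_comm, mul_div_cancel₀ _ hc]

theorem density_nonneg {X Y : Type*} {Sx : Finset X} {Sy : Finset Y} {A : X → Y → ℝ}
    (hA : ZeroOne Sx Sy A) : 0 ≤ density Sx Sy A := by
  refine div_nonneg (Finset.sum_nonneg fun x hx => Finset.sum_nonneg fun y hy => ?_) (by positivity)
  rcases hA x hx y hy with h | h <;> simp [h]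

/-- Removing a row of degree below `(1-ε)·E[A]` from a matrix with at most `n` rows and density
at least `d` increases the density by at least `ε·d/n`; moreover there is a further row. -/
theorem density_erase_of_rowDeg_lt {X Y : Type*} [DecidableEq X] {Sx : Finset X} {Sy : Finset Y}
    {A : X → Y → ℝ} {ε d n : ℝ} {x : X} (hε : 0 < ε) (hd : 0 ≤ d) (hx : x ∈ Sx)
    (hn : (Sx.card : ℝ) ≤ n) (hdS : d ≤ density Sx Sy A)
    (hlt : rowDeg Sy A x < (1 - ε) * density Sx Sy A) :
    (Sx.erase x).Nonempty ∧ density Sx Sy A + ε * d / n ≤ density (Sx.erase x) Sy A := by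
  have hsum := Finset.sum_erase_add Sx (rowDeg Sy A) hx
  rw [← card_mul_density, ← card_mul_density] at hsum
  have hcard : ((Sx.erase x).card : ℝ) + 1 = Sx.card := by
    exact_mod_cast Finset.card_erase_add_one hx
  rw [← hcard] at hsum hn
  have hne : (Sx.erase x).Nonempty := by
    by_contra h
    rw [Finset.not_nonempty_iff_eq_empty] at h
    simp only [h, Finset.card_empty, Nat.cast_zero] at hsum
    nlinarith
  refine ⟨hne, ?_⟩
  have hm : (0 : ℝ) < (Sx.erase x).card := by exact_mod_cast hne.card_pos
  set m : ℝ := ((Sx.erase x).card : ℝ)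
  have hstep : ε * d / n ≤ ε * d / m := by gcongr; linarith
  have hgain : ε * d / m ≤ density (Sx.erase x) Sy A - density Sx Sy A := by
    rw [div_le_iff₀ hm]
    nlinarith
  linarith

theorem exists_minDegree_or_density_increment {X Y : Type*} (Sy : Finset Y) (A : X → Y → ℝ)
    {ε γ d n : ℝ} (hε : 0 < ε) (hd : 0 ≤ d) (hn : 0 < n) (Sx : Finset X) (hS : Sx.Nonempty)
    (hSn : (Sx.card : ℝ) ≤ n) (hfloor : ⌊(1 - γ) * n⌋ ≤ (Sx.card : ℤ))
    (hdens : d + (n - Sx.card) * (ε * d / n) ≤ density Sx Sy A) :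
    ∃ X' : Finset X, X'.Nonempty ∧ ⌊(1 - γ) * n⌋ ≤ (X'.card : ℤ) ∧
      ((MinDegree X' Sy ε A ∧ d ≤ density X' Sy A) ∨ (1 + γ * ε) * d ≤ density X' Sy A) := by
  classical
  induction Sx using Finset.strongInduction with
  | H Sx ih =>
    have hq : 0 ≤ ε * d / n := by positivity
    have hdS : d ≤ density Sx Sy A := by nlinarith
    by_cases hmin : MinDegree Sx Sy ε A
    · exact ⟨Sx, hS, hfloor, Or.inl ⟨hmin, hdS⟩⟩
    simp only [MinDegree, not_forall, not_le] at hmin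
    obtain ⟨x, hx, hlt⟩ := hmin
    obtain ⟨hne, hinc⟩ := density_erase_of_rowDeg_lt hε hd hx hSn hdS hlt
    have hcard := Finset.card_erase_add_one hx
    have hcardR : ((Sx.erase x).card : ℝ) + 1 = Sx.card := by exact_mod_cast hcard
    by_cases hbig : ⌊(1 - γ) * n⌋ ≤ ((Sx.erase x).card : ℤ)
    · refine ih _ (Finset.erase_ssubset hx) hne (by linarith) hbig ?_
      rw [← hcardR] at hdens
      linarith
    · refine ⟨Sx, hS, hfloor, Or.inr ?_⟩
      have hle : (Sx.card : ℝ) ≤ (1 - γ) * n :=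
        Int.le_floor.mp (show (Sx.card : ℤ) ≤ ⌊(1 - γ) * n⌋ by omega)
      have hmul : γ * n * (ε * d / n) ≤ (n - Sx.card) * (ε * d / n) :=
        mul_le_mul_of_nonneg_right (by linarith) hq
      have hcancel : γ * n * (ε * d / n) = γ * ε * d := by field_simp
      linarith

/-- **Minimum degree lemma (existential content).** For a zero-one matrix `A` on finite
nonempty `X × Y`, `ε > 0` and `γ ∈ (0,1)`, there is a nonempty `X' ⊆ X` with
`|X'| ≥ ⌊(1−γ)|X|⌋` such that, with `A' = A[X',Y]`, either `A'` is `ε`-min-degree and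
`E[A'] ≥ E[A]`, or `E[A'] ≥ (1+γε)·E[A]`. -/
theorem min_degree_lemma {X Y : Type*} [Fintype X] [Fintype Y] [Nonempty X] [Nonempty Y]
    (A : X → Y → ℝ) (hA : ZeroOne Finset.univ Finset.univ A)
    (ε γ : ℝ) (hε : 0 < ε) (hγ : γ ∈ Set.Ioo (0 : ℝ) 1) :
    ∃ X' : Finset X, X'.Nonempty ∧
      ((⌊(1 - γ) * (Fintype.card X : ℝ)⌋ : ℝ) ≤ (X'.card : ℝ)) ∧
      ((MinDegree X' Finset.univ ε A ∧
          density Finset.univ Finset.univ A ≤ density X' Finset.univ A) ∨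
        (1 + γ * ε) * density Finset.univ Finset.univ A ≤ density X' Finset.univ A) := by
  have hn : (0 : ℝ) < Fintype.card X := by exact_mod_cast Fintype.card_pos
  have hfloor : ⌊(1 - γ) * (Fintype.card X : ℝ)⌋ ≤ (Fintype.card X : ℤ) := by
    refine Int.floor_le_iff.mpr ?_
    push_cast
    nlinarith [mul_pos hγ.1 hn]
  obtain ⟨X', hne, hcard, h⟩ := exists_minDegree_or_density_increment Finset.univ A (γ := γ) hε
    (density_nonneg hA) hn Finset.univ Finset.univ_nonempty (by simp) (by simpa using hfloor)
    (by simp)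
  exact ⟨X', hne, by exact_mod_cast hcard, h⟩
end

section
/- There exist universal constants c, C > 0 such that the following holds. Let X and Y be finite nonempty sets, let A ∈ {0,1}^{X×Y}, let ε ∈ (0,1) and d ≥ 1, and assume E[A] ≥ 2^{−d}. Then there exist nonempty sets X* ⊆ X and Y* ⊆ Y such that, writing A* = A[X*,Y*]: (1) A* is (ε,2,d)-regular and ε-min-degree; (2) E[A*] ≥ E[A]; (3) |X*|·|Y*| ≥ exp(−C·d^3·ε^{−c}) · |X|·|Y|. -/
open Finset

theorem mul_pow_mul_le_add_pow (k : ℕ) {a b : ℝ} (ha : 0 ≤ a) (hb : 0 ≤ b) :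
    (k + 1) * (a ^ k * b) ≤ k * a ^ (k + 1) + b ^ (k + 1) := by
  induction k with
  | zero => simp
  | succ k ih =>
    have h1 := mul_le_mul_of_nonneg_left ih ha
    have h2 : 0 ≤ (a ^ (k + 1) - b ^ (k + 1)) * (a - b) := by
      rcases le_total a b with h | h
      · have := pow_le_pow_left₀ ha h (k + 1)
        exact mul_nonneg_of_nonpos_of_nonpos (by linarith) (by linarith)
      · have := pow_le_pow_left₀ hb h (k + 1)
        exact mul_nonneg (by linarith) (by linarith)
    push_cast
    ring_nf at h1 h2 ⊢
    linarith

theorem sub_le_pow_sub_pow {a b : ℝ} (ha : 1 ≤ a) (hab : a ≤ b) {d : ℕ} (hd : 1 ≤ d) :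
    b - a ≤ b ^ d - a ^ d := by
  obtain ⟨k, rfl⟩ : ∃ k, d = k + 1 := ⟨d - 1, by omega⟩
  have h1 : a ^ k ≤ b ^ k := pow_le_pow_left₀ (by linarith) hab k
  have h2 : 1 ≤ a ^ k := one_le_pow₀ ha
  rw [pow_succ, pow_succ]
  nlinarith

/-- The number of common neighbours of two rows. -/
noncomputable def codegree {X Y : Type*} (Sy : Finset Y) (A : X → Y → ℝ) (x x' : X) : ℝ :=
  ∑ y ∈ Sy, A x y * A x' y

theorem sum_grid_two {X Y : Type*} (Sx : Finset X) (Sy : Finset Y) (d : ℕ) (A : X → Y → ℝ) :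
    ∑ xs ∈ Fintype.piFinset (fun _ : Fin 2 => Sx), ∑ ys ∈ Fintype.piFinset (fun _ : Fin d => Sy),
      ∏ i : Fin 2, ∏ j : Fin d, A (xs i) (ys j) =
    ∑ x' ∈ Sx, ∑ x ∈ Sx, codegree Sy A x x' ^ d := by
  have h (xs : Fin 2 → X) : ∑ ys ∈ Fintype.piFinset (fun _ : Fin d => Sy),
      ∏ i : Fin 2, ∏ j : Fin d, A (xs i) (ys j) = codegree Sy A (xs 0) (xs 1) ^ d := by
    simp only [Fin.prod_univ_two, ← Finset.prod_mul_distrib]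
    rw [Finset.sum_prod_piFinset Sy (fun _ y => A (xs 0) y * A (xs 1) y)]
    simp [codegree]
  simp only [h]
  rw [← Finset.sum_product']
  refine Finset.sum_nbij' (fun xs => (xs 1, xs 0)) (fun p => ![p.2, p.1]) ?_ ?_ ?_ ?_ ?_
  · intro xs hxs
    simp only [Fintype.mem_piFinset] at hxs
    simp [hxs]
  · intro p hp
    simp only [Finset.mem_product] at hp
    simp [Fintype.mem_piFinset, Fin.forall_fin_two, hp]
  · intro xs _
    ext i
    fin_cases i <;> rfl
  · intro p _
    rfl
  · intro xs _
    rfl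

theorem lt_sum_codegree_pow {X Y : Type*} {Sx : Finset X} {Sy : Finset Y} (hx : Sx.Nonempty)
    (hy : Sy.Nonempty) {A : X → Y → ℝ} (hA : ∀ x y, A x y = 0 ∨ A x y = 1) {ε : ℝ} {d : ℕ}
    (hd : 1 ≤ d) (hpos : 0 ≤ (1 + ε) * density Sx Sy A) (hreg : ¬ GridRegular Sx Sy ε 2 d A) :
    (Sx.card : ℝ) ^ 2 * (Sy.card : ℝ) ^ d * ((1 + ε) * density Sx Sy A) ^ (2 * d) <
      ∑ x' ∈ Sx, ∑ x ∈ Sx, codegree Sy A x x' ^ d := by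
  have hx0 : (0 : ℝ) < Sx.card := by exact_mod_cast hx.card_pos
  have hy0 : (0 : ℝ) < Sy.card := by exact_mod_cast hy.card_pos
  have hA0 (x y) : 0 ≤ A x y := by rcases hA x y with h | h <;> simp [h]
  unfold GridRegular gridNorm at hreg
  rw [sum_grid_two] at hreg
  by_contra! hle
  apply hreg
  set t := (1 + ε) * density Sx Sy A
  have hq : (∑ x' ∈ Sx, ∑ x ∈ Sx, codegree Sy A x x' ^ d) /
      ((Sx.card : ℝ) ^ 2 * (Sy.card : ℝ) ^ d) ≤ t ^ (2 * d) := by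
    rw [div_le_iff₀ (by positivity)]
    linarith
  have hG : 0 ≤ ∑ x' ∈ Sx, ∑ x ∈ Sx, codegree Sy A x x' ^ d :=
    Finset.sum_nonneg fun x' _ => Finset.sum_nonneg fun x _ => pow_nonneg
      (Finset.sum_nonneg fun y _ => mul_nonneg (hA0 _ _) (hA0 _ _)) _
  refine (Real.rpow_le_rpow (by positivity) hq (by positivity)).trans ?_
  have := Real.pow_rpow_inv_natCast hpos (n := 2 * d) (by omega)
  rw [one_div]
  push_cast at this ⊢
  exact this.le

/-- Weighted counts of the rectangles obtained by fixing all but one row and one column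
of a `2 × (k+1)` grid. -/
theorem sum_rectangle_excess {X Y : Type*} (Sx : Finset X) (Sy : Finset Y) (k : ℕ)
    (A : X → Y → ℝ) (θ : ℝ) :
    ∑ x' ∈ Sx, ∑ ys ∈ Fintype.piFinset (fun _ : Fin k => Sy), (∏ j, A x' (ys j)) *
      ∑ x ∈ Sx, ∑ y ∈ Sy, (∏ j, A x (ys j)) * A x' y * (A x y - θ) =
    ∑ x' ∈ Sx, ∑ x ∈ Sx, codegree Sy A x x' ^ (k + 1) -
      θ * ∑ x' ∈ Sx, ∑ x ∈ Sx, codegree Sy A x x' ^ k * ∑ y ∈ Sy, A x' y := by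
  have hc (x x' : X) : codegree Sy A x x' ^ k =
      ∑ ys ∈ Fintype.piFinset (fun _ : Fin k => Sy), (∏ j, A x' (ys j)) * ∏ j, A x (ys j) := by
    simp only [← Finset.prod_mul_distrib]
    rw [Finset.sum_prod_piFinset Sy (fun _ y => A x' y * A x y)]
    simp [codegree, mul_comm]
  have he (x x' : X) : ∑ y ∈ Sy, A x' y * (A x y - θ) =
      codegree Sy A x x' - θ * ∑ y ∈ Sy, A x' y := by
    rw [codegree, Finset.mul_sum, ← Finset.sum_sub_distrib]
    exact Finset.sum_congr rfl fun y _ => by ring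
  rw [Finset.mul_sum, ← Finset.sum_sub_distrib]
  refine Finset.sum_congr rfl fun x' _ => ?_
  rw [Finset.mul_sum, ← Finset.sum_sub_distrib]
  simp only [Finset.mul_sum (s := Sx)]
  rw [Finset.sum_comm]
  refine Finset.sum_congr rfl fun x _ => ?_
  have : codegree Sy A x x' ^ (k + 1) - θ * (codegree Sy A x x' ^ k * ∑ y ∈ Sy, A x' y) =
      codegree Sy A x x' ^ k * ∑ y ∈ Sy, A x' y * (A x y - θ) := by
    rw [he]; ring
  rw [this, hc, Finset.sum_mul]
  refine Finset.sum_congr rfl fun ys _ => ?_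
  simp only [mul_assoc, ← Finset.mul_sum]

theorem exists_of_row_moment {X Y : Type*} {Sx : Finset X} {Sy : Finset Y} (hx : Sx.Nonempty)
    (hy : Sy.Nonempty) {A : X → Y → ℝ} (hA : ∀ x y, A x y = 0 ∨ A x y = 1) {ε δ : ℝ} {d : ℕ}
    (hε : 0 < ε) (hd : 1 ≤ d) (hδ : 0 < δ) (hδ1 : δ ≤ 1)
    (hmom : (Sx.card : ℝ) * (Sy.card : ℝ) ^ d * ((1 + ε / 2) * δ) ^ d ≤
      ∑ x ∈ Sx, (∑ y ∈ Sy, A x y) ^ d) :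
    ∃ Xs : Finset X, Xs.Nonempty ∧ (1 + ε / 4) * δ ≤ density Xs Sy A ∧
      ε / 4 * δ ^ (2 * d) * (Sx.card * Sy.card) ≤ (Xs.card : ℝ) * Sy.card := by
  classical
  have hx0 : (0 : ℝ) < Sx.card := by exact_mod_cast hx.card_pos
  have hy0 : (0 : ℝ) < Sy.card := by exact_mod_cast hy.card_pos
  have hA0 (x y) : 0 ≤ A x y := by rcases hA x y with h | h <;> simp [h]
  have hA1 (x y) : A x y ≤ 1 := by rcases hA x y with h | h <;> simp [h]
  have ha0 (x) : 0 ≤ ∑ y ∈ Sy, A x y := Finset.sum_nonneg fun y _ => hA0 x y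
  have ha1 (x) : ∑ y ∈ Sy, A x y ≤ Sy.card := by
    simpa using Finset.sum_le_card_nsmul Sy (A x) 1 fun y _ => hA1 x y
  set t : ℝ := Sy.card * ((1 + ε / 4) * δ)
  have ht : 0 ≤ t := by positivity
  set Xs := Sx.filter fun x => t ≤ ∑ y ∈ Sy, A x y
  have hup : ∑ x ∈ Sx, (∑ y ∈ Sy, A x y) ^ d ≤ Sx.card * t ^ d + Xs.card * (Sy.card : ℝ) ^ d := by
    have hp : ∀ x ∈ Sx, (∑ y ∈ Sy, A x y) ^ d ≤
        t ^ d + if t ≤ ∑ y ∈ Sy, A x y then (Sy.card : ℝ) ^ d else 0 := by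
      intro x _
      split_ifs with h
      · have := pow_le_pow_left₀ (ha0 x) (ha1 x) d
        have := pow_nonneg ht d
        linarith
      · rw [add_zero]
        exact pow_le_pow_left₀ (ha0 x) (le_of_not_ge h) d
    refine (Finset.sum_le_sum hp).trans_eq ?_
    rw [Finset.sum_add_distrib, ← Finset.sum_filter]
    simp [Xs]
  have hcard : ε / 4 * δ ^ (2 * d) * Sx.card ≤ (Xs.card : ℝ) := by
    have h1 : (Sx.card : ℝ) * δ ^ d * ((1 + ε / 2) ^ d - (1 + ε / 4) ^ d) ≤ Xs.card := by
      have h : (Sy.card : ℝ) ^ d * ((Sx.card : ℝ) * δ ^ d * ((1 + ε / 2) ^ d - (1 + ε / 4) ^ d)) ≤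
          (Sy.card : ℝ) ^ d * Xs.card := by
        have := hmom.trans hup
        simp only [t, mul_pow] at this
        linarith
      exact le_of_mul_le_mul_left h (by positivity)
    have h2 := sub_le_pow_sub_pow (a := 1 + ε / 4) (b := 1 + ε / 2) (by linarith) (by linarith) hd
    have h3 : δ ^ (2 * d) ≤ δ ^ d := pow_le_pow_of_le_one hδ.le hδ1 (by omega)
    calc ε / 4 * δ ^ (2 * d) * Sx.card ≤ ε / 4 * δ ^ d * Sx.card := by gcongr
      _ = Sx.card * δ ^ d * (ε / 4) := by ring
      _ ≤ Sx.card * δ ^ d * ((1 + ε / 2) ^ d - (1 + ε / 4) ^ d) := by gcongr; linarith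
      _ ≤ _ := h1
  have hXs0 : (0 : ℝ) < Xs.card := lt_of_lt_of_le (by positivity) hcard
  refine ⟨Xs, Finset.card_pos.mp (by exact_mod_cast hXs0), ?_, ?_⟩
  · rw [density, le_div_iff₀ (by positivity)]
    have := Finset.card_nsmul_le_sum Xs (fun x => ∑ y ∈ Sy, A x y) t
      fun x hx => (Finset.mem_filter.mp hx).2
    rw [nsmul_eq_mul] at this
    simp only [t] at this
    linarith
  · nlinarith

theorem exists_of_codegree_excess {X Y : Type*} {Sx : Finset X} {Sy : Finset Y} (hx : Sx.Nonempty)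
    (hy : Sy.Nonempty) {A : X → Y → ℝ} (hA : ∀ x y, A x y = 0 ∨ A x y = 1) {θ q : ℝ} {k : ℕ}
    (hθ : 0 ≤ θ) (hq : 0 < q)
    (hex : (Sx.card : ℝ) * (Sy.card : ℝ) ^ k * q ≤
      ∑ x' ∈ Sx, ∑ x ∈ Sx, codegree Sy A x x' ^ (k + 1) -
        θ * ∑ x' ∈ Sx, ∑ x ∈ Sx, codegree Sy A x x' ^ k * ∑ y ∈ Sy, A x' y) :
    ∃ (Xs : Finset X) (Ys : Finset Y), Xs.Nonempty ∧ Ys.Nonempty ∧ θ ≤ density Xs Ys A ∧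
      q ≤ (Xs.card : ℝ) * Ys.card := by
  classical
  have hA0 (x y) : 0 ≤ A x y := by rcases hA x y with h | h <;> simp [h]
  have hA1 (x y) : A x y ≤ 1 := by rcases hA x y with h | h <;> simp [h]
  rw [← sum_rectangle_excess, ← Finset.sum_product'] at hex
  obtain ⟨⟨x', ys⟩, -, h⟩ := Finset.exists_le_of_sum_le (f := fun _ => q)
    (s := Sx ×ˢ Fintype.piFinset (fun _ : Fin k => Sy))
    (hx.product (Fintype.piFinset_nonempty.mpr fun _ => hy))
    (le_trans (le_of_eq (by simp [mul_assoc])) hex)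
  simp only at h
  have hw0 : 0 ≤ ∏ j, A x' (ys j) := Finset.prod_nonneg fun j _ => hA0 _ _
  have hw1 : ∏ j, A x' (ys j) ≤ 1 := Finset.prod_le_one (fun j _ => hA0 _ _) fun j _ => hA1 _ _
  have hS : q ≤ ∑ x ∈ Sx, ∑ y ∈ Sy, (∏ j, A x (ys j)) * A x' y * (A x y - θ) := by
    by_contra! hlt
    rcases le_or_gt 0 (∑ x ∈ Sx, ∑ y ∈ Sy, (∏ j, A x (ys j)) * A x' y * (A x y - θ)) with h0 | h0
    · nlinarith
    · nlinarith
  set Xs := Sx.filter fun x => ∀ j, A x (ys j) = 1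
  set Ys := Sy.filter fun y => A x' y = 1
  have hprod (x) : ∏ j, A x (ys j) = if ∀ j, A x (ys j) = 1 then 1 else 0 := by
    split_ifs with hj
    · simp [hj]
    · push Not at hj
      obtain ⟨j, hj⟩ := hj
      exact Finset.prod_eq_zero (Finset.mem_univ j) ((hA _ _).resolve_right hj)
  have hSeq : ∑ x ∈ Sx, ∑ y ∈ Sy, (∏ j, A x (ys j)) * A x' y * (A x y - θ) =
      ∑ x ∈ Xs, ∑ y ∈ Ys, (A x y - θ) := by
    rw [Finset.sum_filter]
    refine Finset.sum_congr rfl fun x _ => ?_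
    rw [hprod, Finset.sum_filter]
    split_ifs with hj
    · refine Finset.sum_congr rfl fun y _ => ?_
      rcases hA x' y with h | h <;> simp [h]
    · simp
  have hsub : ∑ x ∈ Xs, ∑ y ∈ Ys, (A x y - θ) =
      ∑ x ∈ Xs, ∑ y ∈ Ys, A x y - θ * (Xs.card * Ys.card) := by
    simp [Finset.sum_sub_distrib]
    ring
  have hle : ∑ x ∈ Xs, ∑ y ∈ Ys, A x y ≤ Xs.card * Ys.card := by
    calc ∑ x ∈ Xs, ∑ y ∈ Ys, A x y ≤ ∑ x ∈ Xs, ∑ y ∈ Ys, (1 : ℝ) := by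
          gcongr; exact hA1 _ _
      _ = _ := by simp
  rw [hSeq, hsub] at hS
  have hc0 : (0 : ℝ) ≤ Xs.card * Ys.card := by positivity
  have hsize : q ≤ (Xs.card : ℝ) * Ys.card := by nlinarith
  have hpos : (0 : ℝ) < Xs.card * Ys.card := by linarith
  have hpos' : 0 < Xs.card * Ys.card := by exact_mod_cast hpos
  refine ⟨Xs, Ys, Finset.card_pos.mp (Nat.pos_of_mul_pos_right hpos'),
    Finset.card_pos.mp (Nat.pos_of_mul_pos_left hpos'), ?_, hsize⟩
  rw [density, le_div_iff₀ hpos]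
  linarith

theorem density_le_one {X Y : Type*} (Sx : Finset X) (Sy : Finset Y) {A : X → Y → ℝ}
    (hA : ∀ x y, A x y = 0 ∨ A x y = 1) : density Sx Sy A ≤ 1 := by
  refine div_le_one_of_le₀ ?_ (by positivity)
  calc ∑ x ∈ Sx, ∑ y ∈ Sy, A x y ≤ ∑ x ∈ Sx, ∑ y ∈ Sy, (1 : ℝ) := by
        gcongr with x _ y _
        rcases hA x y with h | h <;> simp [h]
    _ = _ := by simp

/-- **Sifting.** A rectangle that is not grid-regular has a large subrectangle of increased
density. -/
theorem exists_density_increment {X Y : Type*} {Sx : Finset X} {Sy : Finset Y} (hx : Sx.Nonempty)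
    (hy : Sy.Nonempty) {A : X → Y → ℝ} (hA : ∀ x y, A x y = 0 ∨ A x y = 1) {ε : ℝ} {d : ℕ}
    (hε : 0 < ε) (hε1 : ε < 1) (hd : 1 ≤ d) (hδ : 0 < density Sx Sy A)
    (hreg : ¬ GridRegular Sx Sy ε 2 d A) :
    ∃ (Xs : Finset X) (Ys : Finset Y), Xs.Nonempty ∧ Ys.Nonempty ∧
      (1 + ε / 4) * density Sx Sy A ≤ density Xs Ys A ∧
      ε / 4 * density Sx Sy A ^ (2 * d) * (Sx.card * Sy.card) ≤ (Xs.card : ℝ) * Ys.card := by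
  have hx0 : (0 : ℝ) < Sx.card := by exact_mod_cast hx.card_pos
  have hy0 : (0 : ℝ) < Sy.card := by exact_mod_cast hy.card_pos
  have hA0 (x y) : 0 ≤ A x y := by rcases hA x y with h | h <;> simp [h]
  have hG := lt_sum_codegree_pow hx hy hA hd (by positivity) hreg
  have hδ1 := density_le_one Sx Sy hA
  set δ := density Sx Sy A
  rcases le_or_gt ((Sx.card : ℝ) * (Sy.card : ℝ) ^ d * ((1 + ε / 2) * δ) ^ d)
    (∑ x ∈ Sx, (∑ y ∈ Sy, A x y) ^ d) with hmom | hmom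
  · obtain ⟨Xs, h1, h2, h3⟩ := exists_of_row_moment hx hy hA hε hd hδ hδ1 hmom
    exact ⟨Xs, Sy, h1, hy, h2, h3⟩
  obtain ⟨k, rfl⟩ : ∃ k, d = k + 1 := ⟨d - 1, by omega⟩
  set G := ∑ x' ∈ Sx, ∑ x ∈ Sx, codegree Sy A x x' ^ (k + 1) with hGdef
  set P := ∑ x' ∈ Sx, ∑ x ∈ Sx, codegree Sy A x x' ^ k * ∑ y ∈ Sy, A x' y with hPdef
  set t := (1 + ε) * δ with ht
  have ht0 : 0 < t := by positivity
  have hyoung : (k + 1) * (t * P) ≤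
      k * G + t ^ (k + 1) * (Sx.card * ∑ x ∈ Sx, (∑ y ∈ Sy, A x y) ^ (k + 1)) := by
    have e1 : (k + 1) * (t * P) = ∑ x' ∈ Sx, ∑ x ∈ Sx,
        ((k : ℝ) + 1) * (codegree Sy A x x' ^ k * (t * ∑ y ∈ Sy, A x' y)) := by
      simp only [hPdef, Finset.mul_sum (s := Sx)]
      refine Finset.sum_congr rfl fun x' _ => Finset.sum_congr rfl fun x _ => by ring
    have e2 : k * G + t ^ (k + 1) * (Sx.card * ∑ x ∈ Sx, (∑ y ∈ Sy, A x y) ^ (k + 1)) =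
        ∑ x' ∈ Sx, ∑ x ∈ Sx,
          (k * codegree Sy A x x' ^ (k + 1) + (t * ∑ y ∈ Sy, A x' y) ^ (k + 1)) := by
      simp only [Finset.sum_add_distrib, hGdef, Finset.mul_sum (s := Sx), Finset.sum_const,
        nsmul_eq_mul, mul_pow]
      congr 1
      exact Finset.sum_congr rfl fun x' _ => by ring
    rw [e1, e2]
    refine Finset.sum_le_sum fun x' _ => Finset.sum_le_sum fun x _ => mul_pow_mul_le_add_pow k
      (Finset.sum_nonneg fun y _ => mul_nonneg (hA0 _ _) (hA0 _ _))
      (mul_nonneg ht0.le (Finset.sum_nonneg fun y _ => hA0 _ _))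
  have hrow : t ^ (k + 1) * (Sx.card * ∑ x ∈ Sx, (∑ y ∈ Sy, A x y) ^ (k + 1)) ≤ G := by
    calc t ^ (k + 1) * (Sx.card * ∑ x ∈ Sx, (∑ y ∈ Sy, A x y) ^ (k + 1))
        ≤ t ^ (k + 1) * (Sx.card * (Sx.card * (Sy.card : ℝ) ^ (k + 1) * t ^ (k + 1))) := by
          gcongr
          refine hmom.le.trans ?_
          rw [ht]
          gcongr
          linarith
      _ = (Sx.card : ℝ) ^ 2 * (Sy.card : ℝ) ^ (k + 1) * t ^ (2 * (k + 1)) := by ring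
      _ ≤ G := hG.le
  have htP : t * P ≤ G := by
    have : ((k : ℝ) + 1) * (t * P) ≤ (k + 1) * G := by linarith
    exact le_of_mul_le_mul_left this (by positivity)
  have hGlow : (Sx.card : ℝ) ^ 2 * (Sy.card : ℝ) ^ (k + 1) * δ ^ (2 * (k + 1)) ≤ G := by
    refine le_trans ?_ hG.le
    gcongr
    rw [ht]
    nlinarith
  have hexc : ε / 4 * G ≤ G - (1 + ε / 4) * δ * P := by
    have hG0 : 0 ≤ G := le_trans (by positivity) hGlow
    have h1 : (1 + ε) * ((1 + ε / 4) * δ * P) ≤ (1 + ε / 4) * G := by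
      have := mul_le_mul_of_nonneg_left htP (by positivity : 0 ≤ 1 + ε / 4)
      rw [ht] at this
      linarith
    have h2 : (1 + ε) * ((1 + ε / 4) * δ * P) ≤ (1 + ε) * ((1 - ε / 4) * G) := by
      nlinarith [mul_nonneg (mul_nonneg hε.le (sub_nonneg.mpr hε1.le)) hG0, mul_nonneg hε.le hG0]
    have := le_of_mul_le_mul_left h2 (by positivity)
    linarith
  refine exists_of_codegree_excess hx hy hA (θ := (1 + ε / 4) * δ) (k := k) (by positivity)
    (by positivity) (le_trans ?_ hexc)
  calc _ = ε / 4 * ((Sx.card : ℝ) ^ 2 * (Sy.card : ℝ) ^ (k + 1) * δ ^ (2 * (k + 1))) := by ring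
    _ ≤ _ := by gcongr

/-- Deleting a row of low degree increases `size * density ^ K`. -/
theorem exists_erase_row {X Y : Type*} [DecidableEq X] {Sx : Finset X} {Sy : Finset Y}
    (hy : Sy.Nonempty) {A : X → Y → ℝ} {ε : ℝ} {K : ℕ} (hε : 0 < ε) (hK : 1 < K * ε)
    (hδ : 0 < density Sx Sy A) {x : X} (hxS : x ∈ Sx)
    (hdeg : rowDeg Sy A x < (1 - ε) * density Sx Sy A) :
    (Sx.erase x).Nonempty ∧
      (Sx.card : ℝ) * Sy.card * density Sx Sy A ^ K <
        ((Sx.erase x).card : ℝ) * Sy.card * density (Sx.erase x) Sy A ^ K := by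
  have hy0 : (0 : ℝ) < Sy.card := by exact_mod_cast hy.card_pos
  have hcard : ((Sx.erase x).card : ℝ) + 1 = Sx.card := by
    exact_mod_cast Finset.card_erase_add_one hxS
  have hsum : ∑ x ∈ Sx, ∑ y ∈ Sy, A x y = density Sx Sy A * (Sx.card * Sy.card) := by
    have : (0 : ℝ) < Sx.card := by exact_mod_cast Finset.card_pos.mpr ⟨x, hxS⟩
    rw [density, div_mul_cancel₀ _ (by positivity)]
  have herase := Finset.sum_erase_add Sx (fun x => ∑ y ∈ Sy, A x y) hxS
  rw [rowDeg, div_lt_iff₀ hy0] at hdeg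
  set δ := density Sx Sy A
  set n : ℝ := ((Sx.erase x).card : ℝ)
  have hE : δ * (n + ε) * Sy.card < ∑ x ∈ Sx.erase x, ∑ y ∈ Sy, A x y := by
    rw [hsum, ← hcard] at herase
    linarith
  have hne : (Sx.erase x).Nonempty := by
    rw [Finset.nonempty_iff_ne_empty]
    intro h0
    have : n = 0 := by simp [n, h0]
    rw [h0, this, Finset.sum_empty] at hE
    have : 0 < δ * (0 + ε) * Sy.card := by rw [zero_add]; positivity
    linarith
  have hn : 0 < n := by simpa [n] using hne
  refine ⟨hne, ?_⟩
  have hden : δ * (1 + ε / n) ≤ density (Sx.erase x) Sy A := by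
    rw [density, le_div_iff₀ (by positivity)]
    refine le_trans (le_of_eq ?_) hE.le
    change δ * (1 + ε / n) * (n * _) = _
    field_simp
  have hbern : 1 + K * (ε / n) ≤ (1 + ε / n) ^ K :=
    one_add_mul_le_pow (by have : 0 < ε / n := by positivity
                           linarith) K
  calc (Sx.card : ℝ) * Sy.card * δ ^ K = (n + 1) * Sy.card * δ ^ K := by rw [hcard]
    _ < (n + K * ε) * Sy.card * δ ^ K := by gcongr
    _ = n * Sy.card * (δ ^ K * (1 + K * (ε / n))) := by field_simp
    _ ≤ n * Sy.card * (δ ^ K * (1 + ε / n) ^ K) := by gcongr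
    _ = n * Sy.card * (δ * (1 + ε / n)) ^ K := by rw [mul_pow]
    _ ≤ _ := by gcongr

theorem two_pow_lt_pow_of_ceil {ε : ℝ} (hε : 0 < ε) (d : ℕ) :
    1 < (1 + ε / 4) ^ (⌈4 / ε⌉₊ * (2 * d ^ 2 + ⌈4 / ε⌉₊)) * (ε / 4 * (2⁻¹ : ℝ) ^ (2 * d ^ 2)) := by
  set N := ⌈4 / ε⌉₊
  have hN : 4 / ε ≤ N := Nat.le_ceil _
  have hNε : 1 ≤ N * (ε / 4) := by
    rw [div_le_iff₀ hε] at hN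
    linarith
  have h2 : 2 ≤ (1 + ε / 4) ^ N :=
    le_trans (by linarith) (one_add_mul_le_pow (by linarith : -2 ≤ ε / 4) N)
  have hlt : (N : ℝ) < 2 ^ N := by exact_mod_cast Nat.lt_two_pow_self
  calc 1 ≤ N * (ε / 4) := hNε
    _ < 2 ^ N * (ε / 4) := by gcongr
    _ = 2 ^ (2 * d ^ 2 + N) * (ε / 4 * (2⁻¹ : ℝ) ^ (2 * d ^ 2)) := by
      rw [pow_add, inv_pow]; field_simp
    _ ≤ _ := by rw [pow_mul (1 + ε / 4)]; gcongr

/-- **Finding a good rectangle (existential content).** There are universal constants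
`c, C > 0` such that: for every zero-one matrix `A` on finite nonempty `X × Y`,
every `ε ∈ (0,1)` and integer `d ≥ 1` with `E[A] ≥ 2^{−d}`, there exist nonempty
`X* ⊆ X`, `Y* ⊆ Y` such that `A* = A[X*,Y*]` is `(ε,2,d)`-regular and `ε`-min-degree,
`E[A*] ≥ E[A]`, and `|X*||Y*| ≥ exp(−C·d³·ε^{−c})·|X||Y|`. -/
theorem good_rectangle :
    ∃ c C : ℝ, 0 < c ∧ 0 < C ∧
    ∀ (X Y : Type) [Fintype X] [Fintype Y] [Nonempty X] [Nonempty Y]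
      (A : X → Y → ℝ), ZeroOne Finset.univ Finset.univ A →
      ∀ (ε : ℝ) (d : ℕ), ε ∈ Set.Ioo (0 : ℝ) 1 → 1 ≤ d →
      (2 : ℝ) ^ (-(d : ℝ)) ≤ density Finset.univ Finset.univ A →
      ∃ (Xs : Finset X) (Ys : Finset Y), Xs.Nonempty ∧ Ys.Nonempty ∧
        GridRegular Xs Ys ε 2 d A ∧ MinDegree Xs Ys ε A ∧
        density Finset.univ Finset.univ A ≤ density Xs Ys A ∧
        Real.exp (-(C * (d : ℝ) ^ 3 * ε ^ (-c)))
            * ((Fintype.card X : ℝ) * (Fintype.card Y : ℝ))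
          ≤ (Xs.card : ℝ) * (Ys.card : ℝ) := by
  classical
  refine ⟨2, 35, by norm_num, by norm_num, ?_⟩
  intro X Y _ _ _ _ A hA' ε d hε hd hdens
  obtain ⟨hε0, hε1⟩ := hε
  have hA (x y) : A x y = 0 ∨ A x y = 1 := hA' x (Finset.mem_univ _) y (Finset.mem_univ _)
  set N := ⌈4 / ε⌉₊ with hN
  set K := N * (2 * d ^ 2 + N) with hK
  have hdens' : (2⁻¹ : ℝ) ^ d ≤ density Finset.univ Finset.univ A := by
    rwa [Real.rpow_neg (by norm_num), Real.rpow_natCast, ← inv_pow] at hdens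
  have hN4 : 4 / ε ≤ N := Nat.le_ceil _
  have hN5 : (N : ℝ) ≤ 5 / ε := by
    have h1 : (N : ℝ) < 4 / ε + 1 := Nat.ceil_lt_add_one (by positivity)
    have h2 : 1 ≤ 1 / ε := by rw [le_div_iff₀ hε0]; linarith
    have h3 : 5 / ε = 4 / ε + 1 / ε := by ring
    linarith
  have hN1 : 1 ≤ N := Nat.one_le_iff_ne_zero.mpr fun h => by
    rw [h] at hN4
    have : 0 < 4 / ε := by positivity
    simp at hN4
    linarith
  have hd1 : (1 : ℝ) ≤ d := by exact_mod_cast hd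
  have hKε : 1 < K * ε := by
    have h4 : 4 ≤ N * ε := by rwa [div_le_iff₀ hε0] at hN4
    have hKN : (N : ℝ) ≤ K := by
      exact_mod_cast Nat.le_mul_of_pos_right N (by omega)
    nlinarith
  have hK0 : K ≠ 0 := by
    rintro h
    rw [h] at hKε
    norm_num at hKε
  have hKle : (K : ℝ) ≤ 35 * d ^ 2 * ε ^ (-2 : ℝ) := by
    have h1 : 1 ≤ 1 / ε := by rw [le_div_iff₀ hε0]; linarith
    have h2 : ε ^ (-2 : ℝ) = (1 / ε) ^ 2 := by
      rw [Real.rpow_neg hε0.le, one_div, inv_pow]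
      norm_cast
    rw [h2, hK]
    push_cast
    have hN5' : (N : ℝ) ≤ 5 * (1 / ε) := by rw [mul_one_div]; exact hN5
    set r := 1 / ε
    have hd2 : (1 : ℝ) ≤ d ^ 2 := one_le_pow₀ hd1
    calc (N : ℝ) * (2 * d ^ 2 + N) ≤ 5 * r * (2 * d ^ 2 * r + 5 * r * d ^ 2) :=
          mul_le_mul hN5' (add_le_add (le_mul_of_one_le_right (by positivity) h1)
            (hN5'.trans (le_mul_of_one_le_right (by positivity) hd2))) (by positivity)
            (by positivity)
      _ = _ := by ring
  let S : Finset (Finset X × Finset Y) := Finset.univ.filter fun p => p.1.Nonempty ∧ p.2.Nonempty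
  let φ : Finset X × Finset Y → ℝ := fun p => p.1.card * p.2.card * density p.1 p.2 A ^ K
  obtain ⟨⟨Xs, Ys⟩, hmem, hmax⟩ := Finset.exists_max_image S φ
    ⟨(Finset.univ, Finset.univ), by simp [S]⟩
  obtain ⟨hXs, hYs⟩ : Xs.Nonempty ∧ Ys.Nonempty := by simpa [S] using hmem
  have hmax' (Xs' : Finset X) (Ys' : Finset Y) (h1 : Xs'.Nonempty) (h2 : Ys'.Nonempty) :
      (Xs'.card : ℝ) * Ys'.card * density Xs' Ys' A ^ K ≤
        Xs.card * Ys.card * density Xs Ys A ^ K := hmax (Xs', Ys') (by simp [S, h1, h2])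
  have hx0 : (0 : ℝ) < Xs.card := by exact_mod_cast hXs.card_pos
  have hy0 : (0 : ℝ) < Ys.card := by exact_mod_cast hYs.card_pos
  have hXcard : (Xs.card : ℝ) ≤ Fintype.card X := by exact_mod_cast Finset.card_le_univ Xs
  have hYcard : (Ys.card : ℝ) ≤ Fintype.card Y := by exact_mod_cast Finset.card_le_univ Ys
  have hfull := hmax' Finset.univ Finset.univ Finset.univ_nonempty Finset.univ_nonempty
  rw [Finset.card_univ, Finset.card_univ] at hfull
  have hA0 (x y) : 0 ≤ A x y := by rcases hA x y with h | h <;> simp [h]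
  have hδ0 : 0 ≤ density Xs Ys A :=
    div_nonneg (Finset.sum_nonneg fun x _ => Finset.sum_nonneg fun y _ => hA0 x y) (by positivity)
  have hδ1 := density_le_one Xs Ys hA
  set δ₀ := density Finset.univ Finset.univ A
  have hδ₀ : 0 < δ₀ := lt_of_lt_of_le (by positivity) hdens'
  have hinc : δ₀ ≤ density Xs Ys A := by
    have hcc : (0 : ℝ) < Fintype.card X * Fintype.card Y := by positivity
    refine le_of_pow_le_pow_left₀ hK0 hδ0 (le_of_mul_le_mul_left (hfull.trans ?_) hcc)
    gcongr
  have hδpos : 0 < density Xs Ys A := hδ₀.trans_le hinc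
  refine ⟨Xs, Ys, hXs, hYs, ?_, ?_, hinc, ?_⟩
  · by_contra hreg
    obtain ⟨Xs', Ys', h1, h2, h3, h4⟩ :=
      exists_density_increment hXs hYs hA hε0 hε1 hd hδpos hreg
    refine absurd (hmax' Xs' Ys' h1 h2) (not_le.mpr ?_)
    set δ := density Xs Ys A
    have hpow : (2⁻¹ : ℝ) ^ (2 * d ^ 2) ≤ δ ^ (2 * d) := by
      calc (2⁻¹ : ℝ) ^ (2 * d ^ 2) = ((2⁻¹ : ℝ) ^ d) ^ (2 * d) := by rw [← pow_mul]; ring_nf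
        _ ≤ _ := by gcongr; exact hdens'.trans hinc
    calc (Xs.card : ℝ) * Ys.card * δ ^ K = Xs.card * Ys.card * δ ^ K * 1 := by ring
      _ < Xs.card * Ys.card * δ ^ K * ((1 + ε / 4) ^ K * (ε / 4 * (2⁻¹ : ℝ) ^ (2 * d ^ 2))) := by
        gcongr
        exact two_pow_lt_pow_of_ceil hε0 d
      _ ≤ Xs.card * Ys.card * δ ^ K * ((1 + ε / 4) ^ K * (ε / 4 * δ ^ (2 * d))) := by gcongr
      _ = ε / 4 * δ ^ (2 * d) * (Xs.card * Ys.card) * ((1 + ε / 4) * δ) ^ K := by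
        rw [mul_pow]; ring
      _ ≤ _ := by gcongr
  · intro x hx
    by_contra! hdeg
    obtain ⟨h1, h2⟩ := exists_erase_row hYs hε0 hKε hδpos hx hdeg
    exact absurd (hmax' _ _ h1 hYs) (not_le.mpr h2)
  · have hsize : (Fintype.card X : ℝ) * Fintype.card Y * δ₀ ^ K ≤ Xs.card * Ys.card :=
      hfull.trans (mul_le_of_le_one_right (by positivity) (pow_le_one₀ hδ0 hδ1))
    refine le_trans ?_ hsize
    rw [mul_comm]
    gcongr
    have he : Real.exp (-1) ≤ 2⁻¹ := by
      rw [Real.exp_neg]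
      gcongr
      linarith [Real.add_one_le_exp (1 : ℝ)]
    calc Real.exp (-(35 * (d : ℝ) ^ 3 * ε ^ (-2 : ℝ)))
        ≤ Real.exp (((d * K : ℕ) : ℝ) * (-1)) := by
          rw [Real.exp_le_exp]
          push_cast
          have := mul_le_mul_of_nonneg_left hKle (by positivity : (0 : ℝ) ≤ d)
          linarith
      _ = Real.exp (-1) ^ (d * K) := Real.exp_nat_mul _ _
      _ ≤ (2⁻¹ : ℝ) ^ (d * K) := by gcongr
      _ = ((2⁻¹ : ℝ) ^ d) ^ K := pow_mul _ _ _
      _ ≤ δ₀ ^ K := by gcongr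
end
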